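/- Fix q ∈ ℝ with 0 < q < 1/2, D ∈ ℝ, and an integer H ≥ 1. Let a(Δ) := (Q(q)^Δ)_{1,0}, λ := (a(H) − (a(H)+q)D)/(a(H)+Hq), and S := (1−q−D−λ)/q, and assume S ≥ −1 and the optimality condition (a(H+1)−a(H))(S+1) ≤ λ ≤ (a(H)−a(H−1))(S+1). Define s : {integers Δ ≥ 1} → ℝ by s(Δ) := a(Δ)(S+1) − D − λ for Δ ≥ H and s(Δ) := a(H)(S+1) − D − (H−Δ+1)λ for 1 ≤ Δ < H. Then s(1) = 0 and for every integer Δ ≥ 1 the Bellman recursion holds: s(Δ) = max( s(Δ+1), a(Δ)(S+1) − D ) − λ, where for Δ ≥ H the maximum is attained by the second argument (transmit) and for Δ < H by the first argument (idle). -/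

import Mathlib

open Matrix

/-- The one-step transition matrix of a symmetric two-state Markov chain
with switching probability `q`. -/
def Qmat (q : ℝ) : Matrix (Fin 2) (Fin 2) ℝ := !![1 - q, q; q, 1 - q]

/-- `a q Δ` is the `(1,0)` entry of the `Δ`-th power of `Qmat q`. -/
def a (q : ℝ) (Δ : ℕ) : ℝ := (Qmat q ^ Δ) 1 0

theorem Qmat_pow (q : ℝ) (n : ℕ) :
    Qmat q ^ n = !![(1 + (1 - 2 * q) ^ n) / 2, (1 - (1 - 2 * q) ^ n) / 2;
      (1 - (1 - 2 * q) ^ n) / 2, (1 + (1 - 2 * q) ^ n) / 2] := by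
  induction n with
  | zero =>
    ext i j
    fin_cases i <;> fin_cases j <;> simp
  | succ n ih =>
    rw [pow_succ, ih, Qmat]
    ext i j
    fin_cases i <;> fin_cases j <;> simp [Matrix.mul_apply, Fin.sum_univ_two] <;> ring

theorem a_eq (q : ℝ) (n : ℕ) : a q n = (1 - (1 - 2 * q) ^ n) / 2 := by
  simp [a, Qmat_pow]

theorem a_succ_sub (q : ℝ) (n : ℕ) : a q (n + 1) - a q n = q * (1 - 2 * q) ^ n := by
  rw [a_eq, a_eq]
  ring

theorem a_nonneg {q : ℝ} (hq0 : 0 < q) (hq1 : q < 1 / 2) (n : ℕ) : 0 ≤ a q n := by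
  have h : (1 - 2 * q) ^ n ≤ 1 := pow_le_one₀ (by linarith) (by linarith)
  rw [a_eq]
  linarith

theorem a_succ_sub_anti {q : ℝ} (hq0 : 0 < q) (hq1 : q < 1 / 2) {m n : ℕ} (h : m ≤ n) :
    a q (n + 1) - a q n ≤ a q (m + 1) - a q m := by
  rw [a_succ_sub, a_succ_sub]
  exact mul_le_mul_of_nonneg_left
    (pow_le_pow_of_le_one (by linarith) (by linarith) h) hq0.le

theorem stmt_16 (q : ℝ) (hq0 : 0 < q) (hq1 : q < 1/2) (D : ℝ) (H : ℕ) (hH : 1 ≤ H)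
    (lam S : ℝ)
    (hlam : lam = (a q H - (a q H + q) * D) / (a q H + H * q))
    (hS : S = (1 - q - D - lam) / q)
    (hSge : S ≥ -1)
    (hopt₁ : (a q (H + 1) - a q H) * (S + 1) ≤ lam)
    (hopt₂ : lam ≤ (a q H - a q (H - 1)) * (S + 1))
    (s : ℕ → ℝ)
    (hs_ge : ∀ Δ : ℕ, H ≤ Δ → s Δ = a q Δ * (S + 1) - D - lam)
    (hs_lt : ∀ Δ : ℕ, 1 ≤ Δ → Δ < H → s Δ = a q H * (S + 1) - D - ((H : ℝ) - Δ + 1) * lam) :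
    s 1 = 0 ∧
    (∀ Δ : ℕ, 1 ≤ Δ → s Δ = max (s (Δ + 1)) (a q Δ * (S + 1) - D) - lam) ∧
    (∀ Δ : ℕ, H ≤ Δ → s (Δ + 1) ≤ a q Δ * (S + 1) - D) ∧
    (∀ Δ : ℕ, 1 ≤ Δ → Δ < H → a q Δ * (S + 1) - D ≤ s (Δ + 1)) := by
  have hS1 : 0 ≤ S + 1 := by linarith
  have hHpos : (1 : ℝ) ≤ H := by exact_mod_cast hH
  have hden : 0 < a q H + H * q := by
    have := a_nonneg hq0 hq1 H
    positivity
  have hlam' : lam * (a q H + H * q) = a q H - (a q H + q) * D := by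
    rw [hlam]
    exact div_mul_cancel₀ _ hden.ne'
  have hS' : (S + 1) * q = 1 - D - lam := by
    rw [hS]
    field_simp
    ring
  have hs_le : ∀ Δ : ℕ, 1 ≤ Δ → Δ ≤ H →
      s Δ = a q H * (S + 1) - D - ((H : ℝ) - Δ + 1) * lam := by
    intro Δ h1 h2
    rcases h2.lt_or_eq with h | rfl
    · exact hs_lt Δ h1 h
    · rw [hs_ge Δ le_rfl]
      ring
  have hge : ∀ Δ : ℕ, H ≤ Δ → s (Δ + 1) ≤ a q Δ * (S + 1) - D := by
    intro Δ h
    rw [hs_ge (Δ + 1) (by omega)]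
    have := mul_le_mul_of_nonneg_right (a_succ_sub_anti hq0 hq1 h) hS1
    linarith
  have hincr : ∀ k Δ : ℕ, Δ + k ≤ H → k * lam ≤ (a q (Δ + k) - a q Δ) * (S + 1) := by
    intro k Δ
    induction k with
    | zero => simp
    | succ k ih =>
      intro h
      have hanti := a_succ_sub_anti hq0 hq1 (show Δ + k ≤ H - 1 by omega)
      rw [Nat.sub_add_cancel hH] at hanti
      have := mul_le_mul_of_nonneg_right hanti hS1
      have := ih (by omega)
      rw [← add_assoc]
      push_cast
      linarith
  have hlt : ∀ Δ : ℕ, 1 ≤ Δ → Δ < H → a q Δ * (S + 1) - D ≤ s (Δ + 1) := by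
    intro Δ h1 h2
    rw [hs_le (Δ + 1) (by omega) h2]
    have := hincr (H - Δ) Δ (by omega)
    rw [Nat.add_sub_cancel' h2.le, Nat.cast_sub h2.le] at this
    push_cast
    linarith
  refine ⟨?_, ?_, hge, hlt⟩
  · rw [hs_le 1 le_rfl hH]
    push_cast
    refine mul_right_cancel₀ hq0.ne' ?_
    linear_combination a q H * hS' - hlam'
  · intro Δ h1
    rcases le_or_gt H Δ with h | h
    · rw [max_eq_right (hge Δ h), hs_ge Δ h]
    · rw [max_eq_left (hlt Δ h1 h), hs_le Δ h1 h.le, hs_le (Δ + 1) (by omega) h]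
      push_cast
      ring
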